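/- Consider the VCG scoring mechanism with a lender profit threshold c ∈ (0,1), implemented with K reserve borrowers each valued at c: with n ≥ 3 recommenders, m ≥ 1 borrowers, liquidity constraint 1 ≤ K ≤ m, weights w_1,…,w_n > 0 summing to 1 with max_i w_i < min(1 − c, c), and a measurable selection x(·) of value-maximizing feasible allocations. Let μ be a Borel probability measure on ([0,1]^m)^{n−1} with full support (every nonempty open set has positive measure), describing the beliefs of the other recommenders, who report truthfully. Then the mechanism is strictly interim incentive compatible: for every recommender i, every belief p_i ∈ [0,1]^m, and every report p̂_i ≠ p_i, one has E_{p_{-i}∼μ}[U_i(p_i, p_i, p_{-i})] > E_{p_{-i}∼μ}[U_i(p_i, p̂_i, p_{-i})]. -/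

import Mathlib

open MeasureTheory

/-- Combine recommender `i`'s report `ri` with the (truthful) reports `P` of the
other recommenders into a full report profile. -/
noncomputable def combineReports {n m : ℕ} (i : Fin n) (ri : Fin m → ℝ)
    (P : {j : Fin n // j ≠ i} → Fin m → Set.Icc (0:ℝ) 1) : Fin n → Fin m → ℝ :=
  fun j => if h : j = i then ri else fun q => (P ⟨j, h⟩ q : ℝ)

/-- Total value of an allocation `S` when real borrowers are worth `f` and reserves `c`. -/
noncomputable def allocValue {m K : ℕ} (c : ℝ) (f : Fin m → ℝ) (S : Finset (Fin m ⊕ Fin K)) : ℝ :=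
  ∑ e ∈ S, Sum.elim f (fun _ => c) e

section AllocValue

variable {m K : ℕ} {c : ℝ} {f : Fin m → ℝ} {q₀ : Fin m} {S : Finset (Fin m ⊕ Fin K)}

lemma allocValue_le_of_notMem (hc : 0 ≤ c) (hf : ∀ q, q ≠ q₀ → f q ≤ c) (hS : S.card ≤ K)
    (hq : Sum.inl q₀ ∉ S) : allocValue c f S ≤ K * c := by
  have h : allocValue c f S ≤ S.card • c := by
    refine Finset.sum_le_card_nsmul _ _ _ fun e he => ?_
    rcases e with q | k
    · exact hf q fun h => hq (h ▸ he)
    · exact le_rfl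
  rw [nsmul_eq_mul] at h
  exact h.trans (mul_le_mul_of_nonneg_right (by exact_mod_cast hS) hc)

lemma allocValue_le_of_mem (hc : 0 ≤ c) (hf : ∀ q, q ≠ q₀ → f q ≤ c) (hS : S.card ≤ K)
    (hq : Sum.inl q₀ ∈ S) : allocValue c f S ≤ f q₀ + (K - 1) * c := by
  have h : ∑ e ∈ S.erase (Sum.inl q₀), Sum.elim f (fun _ => c) e
      ≤ (S.erase (Sum.inl q₀)).card • c := by
    refine Finset.sum_le_card_nsmul _ _ _ fun e he => ?_
    rcases e with q | k
    · exact hf q fun h => Finset.ne_of_mem_erase he (h ▸ rfl)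
    · exact le_rfl
  have hcard : ((S.erase (Sum.inl q₀)).card : ℝ) ≤ K - 1 := by
    have := Finset.card_erase_add_one hq
    have h' : (S.erase (Sum.inl q₀)).card + 1 ≤ K := by omega
    have h'' : ((S.erase (Sum.inl q₀)).card : ℝ) + 1 ≤ K := by exact_mod_cast h'
    linarith
  rw [nsmul_eq_mul] at h
  rw [allocValue, ← Finset.add_sum_erase S _ hq]
  have := h.trans (mul_le_mul_of_nonneg_right hcard hc)
  simpa using this

lemma le_allocValue_of_isMax
    (hmax : ∀ a : Finset (Fin m ⊕ Fin K), a.card ≤ K → allocValue c f a ≤ allocValue c f S) :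
    K * c ≤ allocValue c f S := by
  refine le_trans (le_of_eq ?_) (hmax (Finset.univ.map Function.Embedding.inr) (by simp))
  simp [allocValue]

lemma add_le_allocValue_of_isMax (hK : 1 ≤ K) (q₀ : Fin m)
    (hmax : ∀ a : Finset (Fin m ⊕ Fin K), a.card ≤ K → allocValue c f a ≤ allocValue c f S) :
    f q₀ + (K - 1) * c ≤ allocValue c f S := by
  have hq : Sum.inl q₀ ∉ ((Finset.univ.erase (⟨0, hK⟩ : Fin K)).map
      (Function.Embedding.inr : Fin K ↪ Fin m ⊕ Fin K)) := by simp
  refine le_trans (le_of_eq ?_) (hmax (Finset.cons (Sum.inl q₀) _ hq) ?_)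
  · rw [allocValue, Finset.sum_cons]
    simp [sub_one_mul]
  · simp only [Finset.card_cons, Finset.card_map, Finset.card_erase_of_mem (Finset.mem_univ _),
      Finset.card_univ, Fintype.card_fin]
    omega

/-- If `f` and `g` place the borrower `q₀` on opposite sides of the reserve value and every other
borrower below it, then a `g`-optimal allocation is strictly suboptimal for `f`. -/
lemma allocValue_lt_of_isMax {g : Fin m → ℝ} {T : Finset (Fin m ⊕ Fin K)} (hK : 1 ≤ K)
    (hc : 0 ≤ c) (hf : ∀ q, q ≠ q₀ → f q ≤ c) (hg : ∀ q, q ≠ q₀ → g q ≤ c)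
    (hfg : f q₀ < c ∧ c < g q₀ ∨ g q₀ < c ∧ c < f q₀) (hT : T.card ≤ K)
    (hSmax : ∀ a : Finset (Fin m ⊕ Fin K), a.card ≤ K → allocValue c f a ≤ allocValue c f S)
    (hTmax : ∀ a : Finset (Fin m ⊕ Fin K), a.card ≤ K → allocValue c g a ≤ allocValue c g T) :
    allocValue c f T < allocValue c f S := by
  have hS₁ := le_allocValue_of_isMax hSmax
  have hS₂ := add_le_allocValue_of_isMax hK q₀ hSmax
  have hT₁ := le_allocValue_of_isMax hTmax
  have hT₂ := add_le_allocValue_of_isMax hK q₀ hTmax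
  by_cases hq : Sum.inl q₀ ∈ T
  · have h₁ := allocValue_le_of_mem hc hf hT hq
    have h₂ := allocValue_le_of_mem hc hg hT hq
    rcases hfg with h | h <;> linarith [h.1, h.2]
  · have h₁ := allocValue_le_of_notMem hc hf hT hq
    have h₂ := allocValue_le_of_notMem hc hg hT hq
    rcases hfg with h | h <;> linarith [h.1, h.2]

end AllocValue

lemma sum_combineReports {n m : ℕ} (w : Fin n → ℝ) (i : Fin n) (r : Fin m → ℝ)
    (P : {j : Fin n // j ≠ i} → Fin m → Set.Icc (0:ℝ) 1) (q : Fin m) :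
    ∑ j, w j * combineReports i r P j q
      = w i * r q + ∑ j : {j : Fin n // j ≠ i}, w j.1 * (P j q : ℝ) := by
  rw [Fintype.sum_eq_add_sum_subtype_ne _ i]
  congr 1
  · simp [combineReports]
  · exact Finset.sum_congr rfl fun j _ => by simp [combineReports, j.2]

/-- Integration is strictly monotone when the strict inequality holds with positive measure. -/
lemma integral_lt_integral_of_measure_lt_pos {α : Type*} [MeasurableSpace α] {μ : Measure α}
    {f g : α → ℝ} (hf : Integrable f μ) (hg : Integrable g μ) (hle : ∀ a, f a ≤ g a)
    (hlt : 0 < μ {a | f a < g a}) : ∫ a, f a ∂μ < ∫ a, g a ∂μ := by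
  rw [← sub_pos, ← integral_sub hg hf,
    integral_pos_iff_support_of_nonneg (fun a => sub_nonneg.mpr (hle a)) (hg.sub hf)]
  exact hlt.trans_le (measure_mono fun a ha => (sub_pos.mpr ha).ne')

/-- Strict interim incentive compatibility of the VCG scoring mechanism with a lender
profit threshold `c ∈ (0,1)`, implemented with `K` reserve borrowers each valued at
`c` (borrowers live in `Fin m ⊕ Fin K`, reserves contributing value `c`): `n ≥ 3`
recommenders, `m ≥ 1` real borrowers, liquidity constraint `1 ≤ K ≤ m`, positive
weights summing to `1` with `max_i w_i < min(1−c, c)`, a selection `x` of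
value-maximizing feasible allocations and a selection `xmi` of allocations
maximizing the others' reported value (including reserve value); the other
recommenders report truthfully with beliefs drawn from a full-support Borel
probability measure `μ` on `([0,1]^m)^{n−1}`; `U pi ri P` is recommender `i`'s
expected VCG utility, and integrability is assumed so the expectations exist.
Then truthful reporting strictly beats every misreport in expectation. -/
theorem stmt_13 (n m K : ℕ) (hn : 3 ≤ n) (hm : 1 ≤ m) (hK1 : 1 ≤ K) (hKm : K ≤ m)
    (c : ℝ) (hc : c ∈ Set.Ioo (0:ℝ) 1)
    (w : Fin n → ℝ) (hw : ∀ j, 0 < w j) (hwsum : ∑ j, w j = 1)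
    (hmax : ∀ j, w j < min (1 - c) c)
    (i : Fin n)
    (x : (Fin n → Fin m → ℝ) → Finset (Fin m ⊕ Fin K))
    (hx : ∀ R : Fin n → Fin m → ℝ, (x R).card ≤ K ∧
      ∀ a : Finset (Fin m ⊕ Fin K), a.card ≤ K →
        (∑ e ∈ a, Sum.elim (fun q => ∑ j, w j * R j q) (fun _ => c) e)
        ≤ ∑ e ∈ x R, Sum.elim (fun q => ∑ j, w j * R j q) (fun _ => c) e)
    (xmi : ({j : Fin n // j ≠ i} → Fin m → Set.Icc (0:ℝ) 1) → Finset (Fin m ⊕ Fin K))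
    (hxmi : ∀ P, (xmi P).card ≤ K ∧
      ∀ a : Finset (Fin m ⊕ Fin K), a.card ≤ K →
        (∑ e ∈ a, Sum.elim
          (fun q => ∑ j : {j : Fin n // j ≠ i}, w j.1 * (P j q : ℝ)) (fun _ => c) e)
        ≤ ∑ e ∈ xmi P, Sum.elim
          (fun q => ∑ j : {j : Fin n // j ≠ i}, w j.1 * (P j q : ℝ)) (fun _ => c) e)
    (μ : Measure ({j : Fin n // j ≠ i} → Fin m → Set.Icc (0:ℝ) 1))
    [IsProbabilityMeasure μ]
    (hfull : ∀ Uo : Set ({j : Fin n // j ≠ i} → Fin m → Set.Icc (0:ℝ) 1),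
      IsOpen Uo → Uo.Nonempty → 0 < μ Uo)
    (U : (Fin m → ℝ) → (Fin m → ℝ) →
      ({j : Fin n // j ≠ i} → Fin m → Set.Icc (0:ℝ) 1) → ℝ)
    (hU : ∀ pi ri P, U pi ri P =
      (∑ e ∈ x (combineReports i ri P), Sum.elim (fun q => w i * pi q) (fun _ => (0:ℝ)) e)
      - ((∑ e ∈ xmi P, Sum.elim
            (fun q => ∑ j : {j : Fin n // j ≠ i}, w j.1 * (P j q : ℝ)) (fun _ => c) e)
         - ∑ e ∈ x (combineReports i ri P), Sum.elim
            (fun q => ∑ j : {j : Fin n // j ≠ i}, w j.1 * (P j q : ℝ)) (fun _ => c) e))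
    (hint : ∀ pi ri : Fin m → ℝ, Integrable (U pi ri) μ)
    (pi : Fin m → ℝ) (hpi : ∀ q, pi q ∈ Set.Icc (0:ℝ) 1)
    (phati : Fin m → ℝ) (hphati : ∀ q, phati q ∈ Set.Icc (0:ℝ) 1)
    (hne : phati ≠ pi) :
    ∫ P, U pi phati P ∂μ < ∫ P, U pi pi P ∂μ := by
  obtain ⟨q₀, hq₀⟩ : ∃ q, phati q ≠ pi q := Function.ne_iff.mp hne
  have hwi := hw i
  obtain ⟨hw₁, hw₂⟩ := lt_min_iff.mp (hmax i)
  set A : ({j : Fin n // j ≠ i} → Fin m → Set.Icc (0:ℝ) 1) → Fin m → ℝ :=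
    fun P q => ∑ j : {j : Fin n // j ≠ i}, w j.1 * (P j q : ℝ) with hA
  have hopt : ∀ r P, ∀ a : Finset (Fin m ⊕ Fin K), a.card ≤ K →
      allocValue c (fun q => w i * r q + A P q) a
        ≤ allocValue c (fun q => w i * r q + A P q) (x (combineReports i r P)) := by
    intro r P a ha
    simpa only [allocValue, hA, ← sum_combineReports] using (hx (combineReports i r P)).2 a ha
  have hUval : ∀ r P, U pi r P
      = allocValue c (fun q => w i * pi q + A P q) (x (combineReports i r P))
        - allocValue c (A P) (xmi P) := by
    intro r P
    have h : allocValue c (fun q => w i * pi q + A P q) (x (combineReports i r P))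
        = (∑ e ∈ x (combineReports i r P), Sum.elim (fun q => w i * pi q) (fun _ => (0:ℝ)) e)
          + ∑ e ∈ x (combineReports i r P), Sum.elim (A P) (fun _ => c) e := by
      rw [allocValue, ← Finset.sum_add_distrib]
      exact Finset.sum_congr rfl fun e _ => by rcases e with q | k <;> simp
    rw [hU, h, allocValue]
    ring
  have hcont : ∀ q, Continuous fun P => A P q := by
    intro q
    simp only [hA]
    fun_prop
  have hpos : 0 < μ {P | (∀ q, q ≠ q₀ → A P q < c - w i) ∧
      c - w i * max (pi q₀) (phati q₀) < A P q₀ ∧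
      A P q₀ < c - w i * min (pi q₀) (phati q₀)} := by
    refine hfull _ ?_ ?_
    · simp only [Set.ofPred_and, Set.ofPred_forall]
      refine (isOpen_iInter_of_finite fun q => isOpen_iInter_of_finite fun _ =>
        isOpen_lt (hcont q) continuous_const).inter
        ((isOpen_lt continuous_const (hcont q₀)).inter (isOpen_lt (hcont q₀) continuous_const))
    · have hp := hpi q₀
      have hph := hphati q₀
      have hd : 0 < 1 - w i := by linarith [hc.1]
      set t := (pi q₀ + phati q₀) / 2 with ht
      have ht0 : 0 ≤ w i * t := mul_nonneg hwi.le (by linarith [hp.1, hph.1])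
      have ht1 : w i * t ≤ w i := mul_le_of_le_one_right hwi.le (by linarith [hp.2, hph.2])
      have hb : (c - w i * t) / (1 - w i) ∈ Set.Icc (0:ℝ) 1 :=
        ⟨div_nonneg (by linarith) hd.le, (div_le_one hd).mpr (by linarith)⟩
      have hsum : ∑ j : {j : Fin n // j ≠ i}, w j.1 = 1 - w i := by
        rw [← hwsum, Fintype.sum_eq_add_sum_subtype_ne _ i]
        ring
      refine ⟨fun _ q => if q = q₀ then ⟨_, hb⟩ else 0, fun q hq => ?_, ?_⟩
      · simp only [hA, if_neg hq]
        simpa using hw₂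
      · have hval : A (fun _ q => if q = q₀ then ⟨_, hb⟩ else 0) q₀ = c - w i * t := by
          simp only [hA, if_true, ← Finset.sum_mul, hsum]
          field_simp
        rw [hval]
        have hmin : min (pi q₀) (phati q₀) < t ∧ t < max (pi q₀) (phati q₀) := by
          rcases lt_or_gt_of_ne hq₀ with h | h
          · rw [min_eq_right h.le, max_eq_left h.le]
            constructor <;> linarith
          · rw [min_eq_left h.le, max_eq_right h.le]
            constructor <;> linarith
        constructor
        · linarith [mul_lt_mul_of_pos_left hmin.2 hwi]
        · linarith [mul_lt_mul_of_pos_left hmin.1 hwi]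
  refine integral_lt_integral_of_measure_lt_pos (hint pi phati) (hint pi pi)
    (fun P => ?_) (hpos.trans_le (measure_mono fun P hP => ?_))
  · simp only [hUval]
    exact sub_le_sub_right (hopt pi P _ (hx _).1) _
  · obtain ⟨hP₁, hP₂, hP₃⟩ := hP
    have hother : ∀ r : Fin m → ℝ, (∀ q, r q ∈ Set.Icc (0:ℝ) 1) →
        ∀ q, q ≠ q₀ → w i * r q + A P q ≤ c := fun r hr q hq => by
      linarith [mul_le_of_le_one_right hwi.le (hr q).2, hP₁ q hq]
    simp only [Set.mem_ofPred_eq, hUval]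
    refine sub_lt_sub_right (allocValue_lt_of_isMax (q₀ := q₀) hK1 hc.1.le (hother pi hpi)
      (hother phati hphati) ?_ (hx _).1 (hopt pi P) (hopt phati P)) _
    rcases lt_or_gt_of_ne hq₀ with h | h
    · rw [min_eq_right h.le] at hP₃
      rw [max_eq_left h.le] at hP₂
      right
      constructor <;> linarith
    · rw [min_eq_left h.le] at hP₃
      rw [max_eq_right h.le] at hP₂
      left
      constructor <;> linarith
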